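/- arXiv:math-ph/0510091 — 3 statements merged into one kernel-verified Lean document; each statement's English description precedes it below -/
import Mathlib

section
/- Assume Hypothesis A, and let n ≥ 0 be an integer with ∫_{ℝ³} |k|^{2n} φ̂(k) dk < ∞. Then for any configuration (x_α, ξ_α)_{α=1,…,N}, the field Ψ is n-times continuously differentiable, the energy H is nonnegative, and sup_{x∈ℝ³} ‖DⁿΨ(x)‖ ≤ (∫_{ℝ³} |k|^{2n} φ̂(k) dk)^{1/2} H^{1/2}. -/
noncomputable section
open MeasureTheory Real Set

/-- Three-dimensional Euclidean space. -/
abbrev E3 := EuclideanSpace ℝ (Fin 3)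

/-- The cross product on `ℝ³`. -/
def cross3 (a b : E3) : E3 := WithLp.toLp 2 (crossProduct a b)

/-- The Fourier transform `∫_{ℝ³} e^{i⟨k,x⟩} f(x) dx` of `f : ℝ³ → ℝ`, as a complex number. -/
def fourierInt (f : E3 → ℝ) (k : E3) : ℂ :=
  ∫ x : E3, Complex.exp (Complex.I * ((inner ℝ k x : ℝ) : ℂ)) * (f x : ℂ)

/-- Hypothesis A: `φ` is even, continuous, integrable, its Fourier transform is the real
nonnegative function `φhat`, and `φhat` satisfies the moment condition (A.4). -/
structure HypA (φ : E3 → ℝ) (φhat : E3 → ℝ) : Prop where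
  even : ∀ x, φ (-x) = φ x
  cont : Continuous φ
  integrable : Integrable φ
  fourier_eq : ∀ k, (φhat k : ℂ) = fourierInt φ k
  nonneg : ∀ k, 0 ≤ φhat k
  moment : Integrable (fun k : E3 => (1 + ‖k‖ ^ 2) ^ 2 * φhat k)

/-- The velocity field `u(x) = ∑_α ∇φ(x − x_α) ∧ ξ_α` of a discrete vorticity
configuration `(x_α, ξ_α)`. -/
def discVel (φ : E3 → ℝ) {N : ℕ} (x ξ : Fin N → E3) (p : E3) : E3 :=
  ∑ α, cross3 (gradient φ (p - x α)) (ξ α)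

/-- The energy `H = (1/2) ∑_{α,β} φ(x_α − x_β) ⟨ξ_α, ξ_β⟩`. -/
def discEnergy (φ : E3 → ℝ) {N : ℕ} (x ξ : Fin N → E3) : ℝ :=
  (1 / 2) * ∑ α, ∑ β, φ (x α - x β) * (inner ℝ (ξ α) (ξ β) : ℝ)

/-- The length `L = ∑_α |ξ_α|` of the configuration. -/
def discLength {N : ℕ} (ξ : Fin N → E3) : ℝ := ∑ α, ‖ξ α‖

/-- The quadratic variation `A = ∑_α |ξ_α|²` of the configuration. -/
def discQuad {N : ℕ} (ξ : Fin N → E3) : ℝ := ∑ α, ‖ξ α‖ ^ 2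

/-- The field `Ψ(x) = ∑_α φ(x − x_α) ξ_α`. -/
def discPsi (φ : E3 → ℝ) {N : ℕ} (x ξ : Fin N → E3) (p : E3) : E3 :=
  ∑ α, φ (p - x α) • ξ α

/-- The curl of a vector field on `ℝ³`, computed with `fderiv`. -/
def curl3 (F : E3 → E3) (p : E3) : E3 :=
  !₂[fderiv ℝ F p (EuclideanSpace.single 1 1) 2 - fderiv ℝ F p (EuclideanSpace.single 2 1) 1,
    fderiv ℝ F p (EuclideanSpace.single 2 1) 0 - fderiv ℝ F p (EuclideanSpace.single 0 1) 2,
    fderiv ℝ F p (EuclideanSpace.single 0 1) 1 - fderiv ℝ F p (EuclideanSpace.single 1 1) 0]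

/-- The function `Φ(x) = ⟨Ψ(x), curl Ψ(x)⟩`. -/
def discPhi (φ : E3 → ℝ) {N : ℕ} (x ξ : Fin N → E3) (p : E3) : ℝ :=
  inner ℝ (discPsi φ x ξ p) (curl3 (discPsi φ x ξ) p)

open scoped FourierTransform

section FourierBounds

variable {V : Type*} [NormedAddCommGroup V] [InnerProductSpace ℝ V] [MeasurableSpace V]
  [BorelSpace V] [FiniteDimensional ℝ V]

theorem norm_iteratedFDeriv_fourier_le_integral {f : V → ℂ} {n : ℕ}
    (hf : ∀ j ≤ n, Integrable (fun v => ‖v‖ ^ j * ‖f v‖)) (hmeas : AEStronglyMeasurable f)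
    (p : V) : ‖iteratedFDeriv ℝ n (𝓕 f) p‖ ≤ (2 * π) ^ n * ∫ v, ‖v‖ ^ n * ‖f v‖ := by
  rw [iteratedFDeriv_fourier (N := (n : ℕ∞)) (fun j hj => hf j (by exact_mod_cast hj)) hmeas le_rfl]
  refine (VectorFourier.norm_fourierIntegral_le_integral_norm _ _ _ _ _).trans ?_
  rw [← integral_const_mul]
  refine integral_mono_of_nonneg (.of_forall fun v => norm_nonneg _)
    ((hf n le_rfl).const_mul _) (.of_forall fun v => ?_)
  refine (VectorFourier.norm_fourierPowSMulRight_le (innerSL ℝ) f v n).trans ?_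
  have h : ‖(innerSL ℝ : V →L[ℝ] V →L[ℝ] ℝ)‖ ≤ 1 := norm_innerSL_le ℝ
  have : (2 * π * ‖(innerSL ℝ : V →L[ℝ] V →L[ℝ] ℝ)‖) ^ n ≤ (2 * π) ^ n := by
    refine pow_le_pow_left₀ (by positivity) ?_ n
    nlinarith [pi_pos]
  dsimp only
  rw [← mul_assoc]
  gcongr

/-- Moments of a nonnegative function interpolate: order `0` and order `2 n` control all orders
up to `n`. -/
theorem integrable_norm_pow_mul_of_le {g : V → ℝ} (hg0 : ∀ v, 0 ≤ g v) (hg : Integrable g)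
    {n : ℕ} (hgn : Integrable (fun v => ‖v‖ ^ (2 * n) * g v)) {j : ℕ} (hj : j ≤ n) :
    Integrable (fun v => ‖v‖ ^ j * g v) := by
  refine (hg.add hgn).mono' ((by fun_prop : Continuous fun v : V => ‖v‖ ^ j).aestronglyMeasurable.mul
    hg.aestronglyMeasurable) (.of_forall fun v => ?_)
  rw [Real.norm_of_nonneg (mul_nonneg (by positivity) (hg0 v))]
  have : ‖v‖ ^ j ≤ 1 + ‖v‖ ^ (2 * n) := by
    rcases le_total ‖v‖ 1 with h | h
    · have := pow_le_one₀ (n := j) (norm_nonneg v) h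
      have : 0 ≤ ‖v‖ ^ (2 * n) := by positivity
      linarith
    · have := pow_le_pow_right₀ h (by omega : j ≤ 2 * n)
      linarith
  simpa [add_mul] using mul_le_mul_of_nonneg_right this (hg0 v)

/-- The Cauchy–Schwarz inequality with a weight. -/
theorem integral_mul_mul_weight_le {α : Type*} [MeasurableSpace α] {μ : Measure α}
    {a b g : α → ℝ} (ha0 : ∀ v, 0 ≤ a v) (hb0 : ∀ v, 0 ≤ b v) (hg0 : ∀ v, 0 ≤ g v)
    (ha : AEStronglyMeasurable a μ) (hb : AEStronglyMeasurable b μ)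
    (hg : AEStronglyMeasurable g μ) (hag : Integrable (fun v => a v ^ 2 * g v) μ)
    (hbg : Integrable (fun v => b v ^ 2 * g v) μ) :
    ∫ v, a v * (g v * b v) ∂μ ≤ √(∫ v, a v ^ 2 * g v ∂μ) * √(∫ v, b v ^ 2 * g v ∂μ) := by
  have hsq (c : α → ℝ) (v : α) : (c v * √(g v)) ^ 2 = c v ^ 2 * g v := by
    rw [mul_pow, Real.sq_sqrt (hg0 v)]
  have hs : AEStronglyMeasurable (fun v => √(g v)) μ :=
    Real.continuous_sqrt.comp_aestronglyMeasurable hg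
  have key := integral_mul_le_Lp_mul_Lq_of_nonneg (μ := μ) Real.HolderConjugate.two_two
    (f := fun v => a v * √(g v)) (g := fun v => b v * √(g v))
    (.of_forall fun v => mul_nonneg (ha0 v) (Real.sqrt_nonneg _))
    (.of_forall fun v => mul_nonneg (hb0 v) (Real.sqrt_nonneg _))
    (by
      rw [ENNReal.ofReal_ofNat]
      exact (memLp_two_iff_integrable_sq (ha.mul hs)).2 (by simpa [hsq] using hag))
    (by
      rw [ENNReal.ofReal_ofNat]
      exact (memLp_two_iff_integrable_sq (hb.mul hs)).2 (by simpa [hsq] using hbg))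
  simp only [Real.rpow_two, hsq, ← Real.sqrt_eq_rpow] at key
  refine le_of_eq_of_le (integral_congr_ae (.of_forall fun v => ?_)) key
  dsimp only
  linear_combination (-(a v * b v)) * Real.mul_self_sqrt (hg0 v)

end FourierBounds

section TrigSums

variable {V F : Type*} [NormedAddCommGroup V] [InnerProductSpace ℝ V]
  [NormedAddCommGroup F] [InnerProductSpace ℝ F] {N : ℕ}

/-- The squared modulus of the structure factor `∑_α e^{2πi⟨v, x_α⟩} ξ_α`. -/
def structureSq (x : Fin N → V) (ξ : Fin N → F) (v : V) : ℝ :=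
  ‖∑ α, Real.cos (2 * π * inner ℝ v (x α)) • ξ α‖ ^ 2 +
    ‖∑ α, Real.sin (2 * π * inner ℝ v (x α)) • ξ α‖ ^ 2

theorem structureSq_nonneg (x : Fin N → V) (ξ : Fin N → F) (v : V) : 0 ≤ structureSq x ξ v := by
  unfold structureSq
  positivity

theorem continuous_structureSq (x : Fin N → V) (ξ : Fin N → F) :
    Continuous (structureSq x ξ) := by
  unfold structureSq
  fun_prop

theorem structureSq_eq_sum (x : Fin N → V) (ξ : Fin N → F) (v : V) :
    structureSq x ξ v =
      ∑ α, ∑ β, Real.cos (2 * π * inner ℝ v (x α - x β)) * (inner ℝ (ξ α) (ξ β) : ℝ) := by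
  simp only [structureSq, ← real_inner_self_eq_norm_sq, sum_inner, inner_sum,
    real_inner_smul_left, real_inner_smul_right, ← Finset.sum_add_distrib]
  refine Finset.sum_congr rfl fun α _ => Finset.sum_congr rfl fun β _ => ?_
  rw [inner_sub_right, mul_sub, Real.cos_sub, real_inner_comm (ξ α) (ξ β)]
  ring

theorem structureSq_le (x : Fin N → V) (ξ : Fin N → F) (v : V) :
    structureSq x ξ v ≤ ∑ α, ∑ β, |(inner ℝ (ξ α) (ξ β) : ℝ)| := by
  rw [structureSq_eq_sum]
  refine Finset.sum_le_sum fun α _ => Finset.sum_le_sum fun β _ => (le_abs_self _).trans ?_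
  rw [abs_mul]
  exact mul_le_of_le_one_left (abs_nonneg _) (Real.abs_cos_le_one _)

theorem norm_sum_fourierChar_mul_inner_le (x : Fin N → V) (ξ : Fin N → F) (w : F) (v : V) :
    ‖∑ α, (𝐞 (inner ℝ v (x α)) : ℂ) * ((inner ℝ w (ξ α) : ℝ) : ℂ)‖ ≤
      ‖w‖ * √(structureSq x ξ v) := by
  have hdecomp : ∑ α, (𝐞 (inner ℝ v (x α)) : ℂ) * ((inner ℝ w (ξ α) : ℝ) : ℂ) =
      ((inner ℝ w (∑ α, Real.cos (2 * π * inner ℝ v (x α)) • ξ α) : ℝ) : ℂ) +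
      ((inner ℝ w (∑ α, Real.sin (2 * π * inner ℝ v (x α)) • ξ α) : ℝ) : ℂ) * Complex.I := by
    simp only [inner_sum, real_inner_smul_right, Complex.ofReal_sum, Finset.sum_mul,
      ← Finset.sum_add_distrib]
    refine Finset.sum_congr rfl fun α _ => ?_
    rw [Real.fourierChar_apply, Complex.exp_mul_I, ← Complex.ofReal_cos, ← Complex.ofReal_sin]
    push_cast
    ring
  rw [hdecomp, Complex.norm_add_mul_I, ← Real.sqrt_sq (norm_nonneg w),
    ← Real.sqrt_mul (sq_nonneg _)]
  refine Real.sqrt_le_sqrt ?_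
  have h (u : F) : (inner ℝ w u : ℝ) ^ 2 ≤ ‖w‖ ^ 2 * ‖u‖ ^ 2 := by
    rw [← mul_pow, ← sq_abs]
    exact pow_le_pow_left₀ (abs_nonneg _) (abs_real_inner_le_norm w u) 2
  rw [structureSq, mul_add]
  exact add_le_add (h _) (h _)

end TrigSums

section Spectral

variable {φ g : E3 → ℝ} {N : ℕ}

theorem integral_cos_mul_of_fourier_eq (hφ : ∀ y, 𝓕 (fun v => (g v : ℂ)) y = φ y)
    (hg : Integrable g) (y : E3) : ∫ v, Real.cos (2 * π * inner ℝ v y) * g v = φ y := by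
  have hint : Integrable (fun v : E3 => 𝐞 (-inner ℝ v y) • (g v : ℂ)) :=
    (Real.fourierIntegral_convergent_iff y).2 hg.ofReal
  have h := congrArg Complex.re (hφ y)
  rw [Real.fourier_eq, ← RCLike.re_eq_complex_re, ← integral_re hint] at h
  rw [← Complex.ofReal_re (φ y), ← RCLike.re_eq_complex_re, ← h]
  refine integral_congr_ae (.of_forall fun v => ?_)
  simp [Circle.smul_def, Real.fourierChar_apply, Complex.exp_re]

theorem integrable_structureSq_mul (hg : Integrable g) (x ξ : Fin N → E3) :
    Integrable (fun v => structureSq x ξ v * g v) := by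
  refine hg.bdd_mul (c := ∑ α, ∑ β, |(inner ℝ (ξ α) (ξ β) : ℝ)|)
    (continuous_structureSq x ξ).aestronglyMeasurable (.of_forall fun v => ?_)
  rw [Real.norm_of_nonneg (structureSq_nonneg x ξ v)]
  exact structureSq_le x ξ v

theorem integral_structureSq_mul (hφ : ∀ y, 𝓕 (fun v => (g v : ℂ)) y = φ y)
    (hg : Integrable g) (x ξ : Fin N → E3) :
    ∫ v, structureSq x ξ v * g v = 2 * discEnergy φ x ξ := by
  have hint (α β : Fin N) : Integrable (fun v =>
      (inner ℝ (ξ α) (ξ β) : ℝ) * (Real.cos (2 * π * inner ℝ v (x α - x β)) * g v)) := by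
    refine (hg.bdd_mul (c := 1) (by fun_prop) (.of_forall fun v => ?_)).const_mul _
    exact Real.abs_cos_le_one _
  calc ∫ v, structureSq x ξ v * g v
      = ∫ v, ∑ α, ∑ β, (inner ℝ (ξ α) (ξ β) : ℝ) *
          (Real.cos (2 * π * inner ℝ v (x α - x β)) * g v) := by
        refine integral_congr_ae (.of_forall fun v => ?_)
        simp only [structureSq_eq_sum, Finset.sum_mul]
        exact Finset.sum_congr rfl fun α _ => Finset.sum_congr rfl fun β _ => by ring
    _ = 2 * discEnergy φ x ξ := by
        rw [integral_finsetSum _ fun α _ => integrable_finsetSum _ fun β _ => hint α β]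
        simp only [integral_finsetSum _ fun β _ => hint _ β, integral_const_mul,
          integral_cos_mul_of_fourier_eq hφ hg, discEnergy]
        rw [← mul_assoc]
        norm_num [mul_comm]

theorem discEnergy_nonneg_of_fourier_eq (hφ : ∀ y, 𝓕 (fun v => (g v : ℂ)) y = φ y)
    (hg0 : ∀ v, 0 ≤ g v) (hg : Integrable g) (x ξ : Fin N → E3) : 0 ≤ discEnergy φ x ξ := by
  have h := integral_structureSq_mul hφ hg x ξ
  have : 0 ≤ ∫ v, structureSq x ξ v * g v :=
    integral_nonneg fun v => mul_nonneg (structureSq_nonneg x ξ v) (hg0 v)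
  linarith

theorem contDiff_discPsi_of_fourier_eq (hφ : ∀ y, 𝓕 (fun v => (g v : ℂ)) y = φ y)
    (hg0 : ∀ v, 0 ≤ g v) (hg : Integrable g) {n : ℕ}
    (hgn : Integrable (fun v => ‖v‖ ^ (2 * n) * g v)) (x ξ : Fin N → E3) :
    ContDiff ℝ (n : ℕ∞) (discPsi φ x ξ) := by
  have hF : ContDiff ℝ (n : ℕ∞) (𝓕 (fun v => (g v : ℂ))) := by
    refine contDiff_fourier fun j hj => ?_
    simpa [abs_of_nonneg (hg0 _)] using
      integrable_norm_pow_mul_of_le hg0 hg hgn (by exact_mod_cast hj)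
  have hφC : ContDiff ℝ (n : ℕ∞) φ := by
    have h : φ = Complex.reCLM ∘ 𝓕 (fun v => (g v : ℂ)) := by
      funext y
      simp [hφ]
    rw [h]
    exact Complex.reCLM.contDiff.comp hF
  unfold discPsi
  exact ContDiff.sum fun α _ => (hφC.comp (contDiff_id.sub contDiff_const)).smul contDiff_const

/-- Each component of `Ψ` is the Fourier transform of the density times a structure factor. -/
theorem inner_discPsi_eq_fourier (hφ : ∀ y, 𝓕 (fun v => (g v : ℂ)) y = φ y)
    (hg : Integrable g) (x ξ : Fin N → E3) (w p : E3) :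
    ((inner ℝ w (discPsi φ x ξ p) : ℝ) : ℂ) =
      𝓕 (fun v => (g v : ℂ) *
        ∑ α, (𝐞 (inner ℝ v (x α)) : ℂ) * ((inner ℝ w (ξ α) : ℝ) : ℂ)) p := by
  have hint (α : Fin N) : Integrable (fun v : E3 =>
      𝐞 (-inner ℝ v (p - x α)) • (g v : ℂ) * ((inner ℝ w (ξ α) : ℝ) : ℂ)) :=
    ((Real.fourierIntegral_convergent_iff (p - x α)).2 hg.ofReal).mul_const _
  simp only [discPsi, inner_sum, real_inner_smul_right, Complex.ofReal_sum, Complex.ofReal_mul,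
    ← hφ, Real.fourier_eq, ← integral_mul_const]
  rw [← integral_finsetSum _ fun α _ => hint α]
  refine integral_congr_ae (.of_forall fun v => ?_)
  simp only [Circle.smul_def, smul_eq_mul, Finset.mul_sum]
  refine Finset.sum_congr rfl fun α _ => ?_
  rw [inner_sub_right, neg_sub, sub_eq_neg_add, AddChar.map_add_eq_mul, Circle.coe_mul]
  ring

theorem integral_norm_pow_mul_sqrt_structureSq_le (hφ : ∀ y, 𝓕 (fun v => (g v : ℂ)) y = φ y)
    (hg0 : ∀ v, 0 ≤ g v) (hg : Integrable g) {n : ℕ}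
    (hgn : Integrable (fun v => ‖v‖ ^ (2 * n) * g v)) (x ξ : Fin N → E3) :
    ∫ v, ‖v‖ ^ n * (g v * √(structureSq x ξ v)) ≤
      √(∫ v, ‖v‖ ^ (2 * n) * g v) * √(2 * discEnergy φ x ξ) := by
  have hsq (v : E3) : (‖v‖ ^ n) ^ 2 = ‖v‖ ^ (2 * n) := by rw [← pow_mul, mul_comm]
  have h := integral_mul_mul_weight_le (μ := volume) (a := fun v : E3 => ‖v‖ ^ n)
    (b := fun v => √(structureSq x ξ v)) (g := g) (fun v => by positivity)
    (fun v => Real.sqrt_nonneg _) hg0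
    (by fun_prop : Continuous fun v : E3 => ‖v‖ ^ n).aestronglyMeasurable
    (continuous_structureSq x ξ).sqrt.aestronglyMeasurable hg.aestronglyMeasurable
    (by simpa only [hsq] using hgn)
    (by simpa only [Real.sq_sqrt (structureSq_nonneg x ξ _)] using
      integrable_structureSq_mul hg x ξ)
  simpa only [hsq, Real.sq_sqrt (structureSq_nonneg x ξ _),
    integral_structureSq_mul hφ hg x ξ] using h

theorem norm_iteratedFDeriv_inner_discPsi_le (hφ : ∀ y, 𝓕 (fun v => (g v : ℂ)) y = φ y)
    (hg0 : ∀ v, 0 ≤ g v) (hg : Integrable g) {n : ℕ}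
    (hgn : Integrable (fun v => ‖v‖ ^ (2 * n) * g v)) (x ξ : Fin N → E3) (w p : E3) :
    ‖iteratedFDeriv ℝ n (fun q => ((inner ℝ w (discPsi φ x ξ q) : ℝ) : ℂ)) p‖ ≤
      (2 * π) ^ n * (‖w‖ * (√(∫ v, ‖v‖ ^ (2 * n) * g v) * √(2 * discEnergy φ x ξ))) := by
  rw [funext fun q => inner_discPsi_eq_fourier hφ hg x ξ w q]
  set s : E3 → ℂ := fun v => ∑ α, (𝐞 (inner ℝ v (x α)) : ℂ) * ((inner ℝ w (ξ α) : ℝ) : ℂ)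
  have hs_cont : Continuous s := by
    refine continuous_finsetSum _ fun α _ => Continuous.mul ?_ continuous_const
    exact continuous_subtype_val.comp (Real.continuous_fourierChar.comp (by fun_prop))
  have hs_le (v : E3) : ‖s v‖ ≤ ‖w‖ * √(structureSq x ξ v) :=
    norm_sum_fourierChar_mul_inner_le x ξ w v
  have hs_bdd (v : E3) : ‖s v‖ ≤ ∑ α, ‖(inner ℝ w (ξ α) : ℝ)‖ :=
    (norm_sum_le _ _).trans (Finset.sum_le_sum fun α _ => by simp [Circle.norm_coe])
  have hmeas : AEStronglyMeasurable (fun v => (g v : ℂ) * s v) :=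
    hg.ofReal.aestronglyMeasurable.mul hs_cont.aestronglyMeasurable
  have hmom (j : ℕ) (hj : j ≤ n) : Integrable (fun v => ‖v‖ ^ j * ‖(g v : ℂ) * s v‖) := by
    have := (integrable_norm_pow_mul_of_le hg0 hg hgn hj).mul_bdd
      hs_cont.norm.aestronglyMeasurable (.of_forall fun v => by simpa using hs_bdd v)
    simpa [abs_of_nonneg (hg0 _), mul_assoc] using this
  have hint : Integrable (fun v => ‖v‖ ^ n * (g v * √(structureSq x ξ v))) := by
    have := (integrable_norm_pow_mul_of_le hg0 hg hgn le_rfl).mul_bdd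
      (continuous_structureSq x ξ).sqrt.aestronglyMeasurable
      (c := √(∑ α, ∑ β, |(inner ℝ (ξ α) (ξ β) : ℝ)|)) (.of_forall fun v => ?_)
    · simpa [mul_assoc] using this
    · rw [Real.norm_of_nonneg (Real.sqrt_nonneg _)]
      exact Real.sqrt_le_sqrt (structureSq_le x ξ v)
  refine (norm_iteratedFDeriv_fourier_le_integral hmom hmeas p).trans
    (mul_le_mul_of_nonneg_left ?_ (by positivity))
  refine (integral_mono (hmom n le_rfl) (hint.const_mul ‖w‖) fun v => ?_).trans ?_
  · have := mul_le_mul_of_nonneg_left (hs_le v)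
      (mul_nonneg (pow_nonneg (norm_nonneg v) n) (hg0 v))
    simp only [norm_mul, Complex.norm_real, Real.norm_of_nonneg (hg0 v)]
    linarith
  · rw [integral_const_mul]
    exact mul_le_mul_of_nonneg_left
      (integral_norm_pow_mul_sqrt_structureSq_le hφ hg0 hg hgn x ξ) (norm_nonneg w)

theorem norm_iteratedFDeriv_discPsi_le_of_fourier_eq
    (hφ : ∀ y, 𝓕 (fun v => (g v : ℂ)) y = φ y)
    (hg0 : ∀ v, 0 ≤ g v) (hg : Integrable g) {n : ℕ}
    (hgn : Integrable (fun v => ‖v‖ ^ (2 * n) * g v)) (x ξ : Fin N → E3) (p : E3) :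
    ‖iteratedFDeriv ℝ n (discPsi φ x ξ) p‖ ≤
      (2 * π) ^ n * (√(∫ v, ‖v‖ ^ (2 * n) * g v) * √(2 * discEnergy φ x ξ)) := by
  refine ContinuousMultilinearMap.opNorm_le_bound (by positivity) fun m => ?_
  obtain ⟨w, hw⟩ : ∃ w, w = iteratedFDeriv ℝ n (discPsi φ x ξ) p m := ⟨_, rfl⟩
  rw [← hw]
  have hcomp := norm_iteratedFDeriv_inner_discPsi_le hφ hg0 hg hgn x ξ w p
  have hB : 0 ≤ √(∫ v, ‖v‖ ^ (2 * n) * g v) * √(2 * discEnergy φ x ξ) := by positivity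
  generalize √(∫ v, ‖v‖ ^ (2 * n) * g v) * √(2 * discEnergy φ x ξ) = B at hcomp hB ⊢
  let T : E3 →L[ℝ] ℂ := Complex.ofRealCLM ∘L innerSL ℝ w
  have hTw : ‖w‖ * ‖w‖ =
      ‖iteratedFDeriv ℝ n (fun q => ((inner ℝ w (discPsi φ x ξ q) : ℝ) : ℂ)) p m‖ := by
    change _ = ‖iteratedFDeriv ℝ n (T ∘ discPsi φ x ξ) p m‖
    rw [T.iteratedFDeriv_comp_left
      (contDiff_discPsi_of_fourier_eq hφ hg0 hg hgn x ξ).contDiffAt le_rfl,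
      ContinuousLinearMap.compContinuousMultilinearMap_coe, Function.comp_apply, ← hw]
    simp [T, sq]
  have hfin : ‖w‖ * ‖w‖ ≤ ‖w‖ * ((2 * π) ^ n * B * ∏ i, ‖m i‖) :=
    calc ‖w‖ * ‖w‖ ≤ ((2 * π) ^ n * (‖w‖ * B)) * ∏ i, ‖m i‖ :=
          hTw ▸ ContinuousMultilinearMap.le_of_opNorm_le hcomp m
      _ = ‖w‖ * ((2 * π) ^ n * B * ∏ i, ‖m i‖) := by ring
  rcases (norm_nonneg w).eq_or_lt with h0 | hpos
  · exact h0.symm.le.trans (mul_nonneg (by positivity) (Finset.prod_nonneg fun i _ => norm_nonneg _))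
  · exact le_of_mul_le_mul_left hfin hpos

end Spectral

namespace HypA

variable {φ φhat : E3 → ℝ}

theorem fourierInv_eq (hA : HypA φ φhat) (v : E3) :
    𝓕⁻ (fun y => (φ y : ℂ)) v = φhat ((2 * π) • v) := by
  rw [hA.fourier_eq, fourierInt, Real.fourierInv_eq]
  refine integral_congr_ae (.of_forall fun y => ?_)
  simp only [Circle.smul_def, smul_eq_mul, Real.fourierChar_apply, real_inner_smul_left,
    real_inner_comm v y]
  rw [mul_comm Complex.I]

theorem integrable_hat (hA : HypA φ φhat) : Integrable φhat := by
  have hc : Continuous fun k : E3 => ((1 + ‖k‖ ^ 2) ^ 2)⁻¹ := by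
    refine Continuous.inv₀ (by fun_prop) fun k => ?_
    positivity
  refine (hA.moment.bdd_mul (c := 1) hc.aestronglyMeasurable (.of_forall fun k => ?_)).congr
    (.of_forall fun k => ?_)
  · rw [Real.norm_of_nonneg (by positivity)]
    exact inv_le_one_of_one_le₀ (one_le_pow₀ (by nlinarith [sq_nonneg ‖k‖]))
  · have : (1 + ‖k‖ ^ 2) ^ 2 ≠ 0 := by positivity
    dsimp only
    field_simp

theorem integrable_hat_smul (hA : HypA φ φhat) : Integrable (fun v => φhat ((2 * π) • v)) :=
  hA.integrable_hat.comp_smul (by positivity)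

theorem fourier_hat_smul (hA : HypA φ φhat) (y : E3) :
    𝓕 (fun v => (φhat ((2 * π) • v) : ℂ)) y = φ y := by
  have h : 𝓕⁻ (fun y => (φ y : ℂ)) = fun v => (φhat ((2 * π) • v) : ℂ) := funext hA.fourierInv_eq
  rw [← h]
  refine congrFun (Continuous.fourier_fourierInv_eq (f := fun y => (φ y : ℂ))
    (Complex.continuous_ofReal.comp hA.cont) hA.integrable.ofReal ?_) y
  have h' : 𝓕 (fun y => (φ y : ℂ)) = fun v => (φhat ((2 * π) • (-v)) : ℂ) := by
    funext v
    rw [← hA.fourierInv_eq, Real.fourierInv_eq_fourier_neg, neg_neg]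
  rw [h']
  exact Integrable.comp_neg (f := fun v : E3 => (φhat ((2 * π) • v) : ℂ))
    hA.integrable_hat_smul.ofReal

end HypA

theorem norm_pow_mul_comp_smul (φhat : E3 → ℝ) (n : ℕ) (v : E3) :
    ‖v‖ ^ (2 * n) * φhat ((2 * π) • v) =
      ((2 * π) ^ (2 * n))⁻¹ * (‖(2 * π) • v‖ ^ (2 * n) * φhat ((2 * π) • v)) := by
  rw [norm_smul, Real.norm_of_nonneg (by positivity), mul_pow (2 * π) ‖v‖]
  field_simp

theorem integral_norm_pow_mul_comp_smul (φhat : E3 → ℝ) (n : ℕ) :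
    ∫ v : E3, ‖v‖ ^ (2 * n) * φhat ((2 * π) • v) =
      ((2 * π) ^ (2 * n))⁻¹ * (((2 * π) ^ 3)⁻¹ * ∫ k : E3, ‖k‖ ^ (2 * n) * φhat k) := by
  simp only [norm_pow_mul_comp_smul φhat n]
  rw [integral_const_mul, Measure.integral_comp_smul_of_nonneg volume
    (fun k : E3 => ‖k‖ ^ (2 * n) * φhat k) (2 * π) (hR := by positivity)]
  simp

/-- The field `Ψ` is `n`-times continuously differentiable, the energy is
nonnegative, and `sup_x ‖DⁿΨ(x)‖ ≤ (∫ |k|^{2n} φ̂(k) dk)^{1/2} H^{1/2}`. -/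
theorem discPsi_derivative_bound (φ φhat : E3 → ℝ) (hA : HypA φ φhat) (n : ℕ)
    (hmom : Integrable (fun k : E3 => ‖k‖ ^ (2 * n) * φhat k))
    (N : ℕ) (hN : 0 < N) (x ξ : Fin N → E3) :
    ContDiff ℝ (n : ℕ∞) (discPsi φ x ξ) ∧
    0 ≤ discEnergy φ x ξ ∧
    ∀ p : E3, ‖iteratedFDeriv ℝ n (discPsi φ x ξ) p‖ ≤
      Real.sqrt (∫ k : E3, ‖k‖ ^ (2 * n) * φhat k) * Real.sqrt (discEnergy φ x ξ) := by
  have hφ := hA.fourier_hat_smul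
  have hg0 : ∀ v : E3, 0 ≤ φhat ((2 * π) • v) := fun v => hA.nonneg _
  have hg := hA.integrable_hat_smul
  have hgn : Integrable (fun v : E3 => ‖v‖ ^ (2 * n) * φhat ((2 * π) • v)) := by
    simp only [norm_pow_mul_comp_smul φhat n]
    exact (hmom.comp_smul (by positivity : (2 * π) ≠ 0)).const_mul _
  have hH := discEnergy_nonneg_of_fourier_eq hφ hg0 hg x ξ
  refine ⟨contDiff_discPsi_of_fourier_eq hφ hg0 hg hgn x ξ, hH, fun p => ?_⟩
  refine (norm_iteratedFDeriv_discPsi_le_of_fourier_eq hφ hg0 hg hgn x ξ p).trans ?_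
  have hM : 0 ≤ ∫ k : E3, ‖k‖ ^ (2 * n) * φhat k :=
    integral_nonneg fun k => mul_nonneg (by positivity) (hA.nonneg k)
  have hπ : ((2 * π) ^ 3)⁻¹ * 2 ≤ 1 := by
    rw [inv_mul_le_iff₀ (by positivity), mul_one]
    nlinarith [one_le_pow₀ (n := 3) (by linarith [pi_gt_three] : 1 ≤ π), mul_pow 2 π 3]
  have hpow : (2 * π) ^ n = √((2 * π) ^ (2 * n)) := by
    rw [mul_comm 2 n, pow_mul, Real.sqrt_sq (by positivity)]
  rw [integral_norm_pow_mul_comp_smul, hpow, ← Real.sqrt_mul (by positivity),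
    ← Real.sqrt_mul (by positivity), ← Real.sqrt_mul hM]
  refine Real.sqrt_le_sqrt ?_
  rw [mul_assoc, mul_inv_cancel_left₀ (by positivity)]
  nlinarith [mul_le_mul_of_nonneg_right hπ (mul_nonneg hM hH)]
end
end

section
/- Let φ : ℝ³ → ℝ be three times continuously differentiable and even. Let (x_α(t), ξ_α(t))_{α=1,…,N} be continuously differentiable curves in ℝ³ on an interval [0,T] satisfying ẋ_α(t) = u_t(x_α(t)), where u_t(x) = ∑_{α=1}^N ∇φ(x − x_α(t)) ∧ ξ_α(t); no equation is imposed on ξ̇_α. Set Ψ_t(x) = ∑_{α=1}^N φ(x − x_α(t)) ξ_α(t), Φ_t(x) = ⟨Ψ_t(x), curl Ψ_t(x)⟩, and H(t) = (1/2) ∑_{α,β=1}^N φ(x_α(t) − x_β(t)) ⟨ξ_α(t), ξ_β(t)⟩. Then for every t, dH/dt = ∑_{β=1}^N ⟨Ψ_t(x_β(t)), ξ̇_β(t) − Du_t(x_β(t)) ξ_β(t)⟩ + ∑_{β=1}^N ⟨ξ_β(t), ∇Φ_t(x_β(t))⟩, where Du_t(x) is the Jacobian matrix of u_t at x (so (Du_t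 ξ)^i = ∑_j ∂_j u_t^i ξ^j). -/
noncomputable section
open MeasureTheory Real Set

theorem inner_cross3_cross3 (a b v w : E3) :
    inner ℝ w (cross3 (cross3 a b) v) =
      inner ℝ a v * inner ℝ w b - inner ℝ a w * inner ℝ b v := by
  simp [cross3, crossProduct, PiLp.inner_apply, Fin.sum_univ_three]
  ring

theorem inner_cross3_self (a w : E3) : inner ℝ w (cross3 a a) = 0 := by
  simp [cross3]

theorem cross3_sum_left {ι : Type*} (s : Finset ι) (f : ι → E3) (v : E3) :
    cross3 (∑ i ∈ s, f i) v = ∑ i ∈ s, cross3 (f i) v := by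
  simp [cross3]

theorem hasFDerivAt_inner_gradient {φ : E3 → ℝ} (hφ : Differentiable ℝ φ) (p : E3) :
    HasFDerivAt φ (innerSL ℝ (gradient φ p)) p :=
  (hφ p).hasGradientAt.hasFDerivAt

theorem gradient_neg_of_even {φ : E3 → ℝ} (heven : ∀ x, φ (-x) = φ x) (p : E3) :
    gradient φ (-p) = -gradient φ p := by
  refine ext_inner_right ℝ fun v => ?_
  have h := fderiv_comp_smul (𝕜 := ℝ) (f := φ) (c := -1) (x := p)
  simp only [neg_one_smul, heven] at h
  rw [inner_neg_left, inner_gradient_left, inner_gradient_left]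
  change _ = -((fderiv ℝ (fun y => φ y) p) v)
  rw [h]
  simp

/-- The derivative of `discPsi`. -/
theorem hasFDerivAt_discPsi {φ : E3 → ℝ} (hφ : Differentiable ℝ φ) {N : ℕ}
    (x ξ : Fin N → E3) (p : E3) :
    HasFDerivAt (discPsi φ x ξ)
      (∑ α, (innerSL ℝ (gradient φ (p - x α))).smulRight (ξ α)) p := by
  unfold discPsi
  refine HasFDerivAt.fun_sum fun α _ => ?_
  exact ((hasFDerivAt_inner_gradient hφ (p - x α)).comp p
    ((hasFDerivAt_id p).sub_const (x α))).smul_const (ξ α)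

theorem fderiv_discPsi_apply {φ : E3 → ℝ} (hφ : Differentiable ℝ φ) {N : ℕ}
    (x ξ : Fin N → E3) (p v : E3) :
    fderiv ℝ (discPsi φ x ξ) p v = ∑ α, inner ℝ (gradient φ (p - x α)) v • ξ α := by
  simp [(hasFDerivAt_discPsi hφ x ξ p).fderiv]

/-- The velocity field is the curl of `discPsi`. -/
theorem curl3_discPsi {φ : E3 → ℝ} (hφ : Differentiable ℝ φ) {N : ℕ}
    (x ξ : Fin N → E3) (p : E3) :
    curl3 (discPsi φ x ξ) p = discVel φ x ξ p := by
  ext i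
  simp only [curl3, discVel, cross3, fderiv_discPsi_apply hφ]
  fin_cases i <;>
    simp [crossProduct, EuclideanSpace.inner_single_right, ← Finset.sum_sub_distrib,
      -inner_gradient_left]

/-- Since `curl Ψ = u`, the antisymmetric part of `DΨ` annihilates `u`. -/
theorem inner_fderiv_discPsi_discVel {φ : E3 → ℝ} (hφ : Differentiable ℝ φ) {N : ℕ}
    (x ξ : Fin N → E3) (p w : E3) :
    inner ℝ w (fderiv ℝ (discPsi φ x ξ) p (discVel φ x ξ p)) =
      inner ℝ (fderiv ℝ (discPsi φ x ξ) p w) (discVel φ x ξ p) := by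
  have key : ∀ v : E3, inner ℝ w (cross3 (discVel φ x ξ p) v) =
      inner ℝ w (fderiv ℝ (discPsi φ x ξ) p v) -
        inner ℝ (fderiv ℝ (discPsi φ x ξ) p w) v := by
    intro v
    rw [discVel, cross3_sum_left, fderiv_discPsi_apply hφ, fderiv_discPsi_apply hφ]
    simp only [inner_sum, sum_inner, inner_cross3_cross3, inner_smul_left, inner_smul_right,
      Finset.sum_sub_distrib]
    simp
  have h := key (discVel φ x ξ p)
  rw [inner_cross3_self] at h
  linarith

theorem differentiable_cross3_const {F : E3 → E3} (hF : Differentiable ℝ F) (b : E3) :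
    Differentiable ℝ fun p => cross3 (F p) b := by
  have hi : ∀ i, Differentiable ℝ fun p => F p i := fun i => by fun_prop
  rw [differentiable_euclidean]
  intro i
  fin_cases i <;> simp [cross3, crossProduct] <;> fun_prop

theorem differentiable_gradient {φ : E3 → ℝ} (hφ : ContDiff ℝ 2 φ) :
    Differentiable ℝ (gradient φ) :=
  (InnerProductSpace.toDual ℝ E3).symm.differentiable.comp
    ((hφ.fderiv_right (m := 1) (by norm_num)).differentiable (by norm_num))

theorem differentiable_discVel {φ : E3 → ℝ} (hφ : ContDiff ℝ 2 φ) {N : ℕ}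
    (x ξ : Fin N → E3) : Differentiable ℝ (discVel φ x ξ) := by
  unfold discVel
  refine Differentiable.fun_sum fun α _ => ?_
  refine differentiable_cross3_const (F := fun p => gradient φ (p - x α)) ?_ (ξ α)
  exact (differentiable_gradient hφ).comp (differentiable_id.sub_const (x α))

theorem inner_gradient_discPhi {φ : E3 → ℝ} (hφ : ContDiff ℝ 2 φ) {N : ℕ}
    (x ξ : Fin N → E3) (p w : E3) :
    inner ℝ w (gradient (discPhi φ x ξ) p) =
      inner ℝ (discPsi φ x ξ p) (fderiv ℝ (discVel φ x ξ) p w) +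
        inner ℝ (fderiv ℝ (discPsi φ x ξ) p w) (discVel φ x ξ p) := by
  have hd : Differentiable ℝ φ := hφ.differentiable (by norm_num)
  have hΦ : discPhi φ x ξ = fun p => inner ℝ (discPsi φ x ξ p) (discVel φ x ξ p) := by
    funext q
    rw [discPhi, curl3_discPsi hd]
  rw [real_inner_comm, inner_gradient_left, hΦ]
  exact fderiv_inner_apply ℝ (hasFDerivAt_discPsi hd x ξ p).differentiableAt
    (differentiable_discVel hφ x ξ p) w

/-- The derivative of the energy along arbitrary differentiable curves. -/
theorem hasDerivAt_discEnergy {φ : E3 → ℝ} (hφ : Differentiable ℝ φ)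
    (heven : ∀ x, φ (-x) = φ x) {N : ℕ} {x ξ : Fin N → ℝ → E3} {x' ξ' : Fin N → E3} {t : ℝ}
    (hx : ∀ α, HasDerivAt (x α) (x' α) t) (hξ : ∀ α, HasDerivAt (ξ α) (ξ' α) t) :
    HasDerivAt (fun s => discEnergy φ (fun β => x β s) (fun β => ξ β s))
      ((∑ β, inner ℝ (discPsi φ (fun β' => x β' t) (fun β' => ξ β' t) (x β t)) (ξ' β)) +
        ∑ β, inner ℝ (ξ β t)
          (fderiv ℝ (discPsi φ (fun β' => x β' t) (fun β' => ξ β' t)) (x β t) (x' β))) t := by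
  have hterm : ∀ α β, HasDerivAt (fun s => φ (x α s - x β s) * inner ℝ (ξ α s) (ξ β s))
      (inner ℝ (gradient φ (x α t - x β t)) (x' α - x' β) * inner ℝ (ξ α t) (ξ β t) +
        φ (x α t - x β t) * (inner ℝ (ξ α t) (ξ' β) + inner ℝ (ξ' α) (ξ β t))) t := by
    intro α β
    exact ((hasFDerivAt_inner_gradient hφ _).comp_hasDerivAt t ((hx α).sub (hx β))).mul
      ((hξ α).inner ℝ (hξ β))
  have hsum := (HasDerivAt.fun_sum (u := Finset.univ) fun α _ =>
    HasDerivAt.fun_sum (u := Finset.univ) fun β _ => hterm α β).const_mul (1 / 2 : ℝ)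
  unfold discEnergy
  refine hsum.congr_deriv ?_
  have hφsymm : ∀ α β, φ (x α t - x β t) = φ (x β t - x α t) := fun α β => by
    rw [← heven, neg_sub]
  have hgrad : ∀ α β, gradient φ (x α t - x β t) = -gradient φ (x β t - x α t) := fun α β => by
    rw [← gradient_neg_of_even heven, neg_sub]
  let P : Fin N → Fin N → ℝ := fun α β => φ (x α t - x β t) * inner ℝ (ξ β t) (ξ' α)
  let Q : Fin N → Fin N → ℝ := fun α β =>
    inner ℝ (gradient φ (x α t - x β t)) (x' α) * inner ℝ (ξ α t) (ξ β t)
  have hsplit : ∀ α β,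
      inner ℝ (gradient φ (x α t - x β t)) (x' α - x' β) * inner ℝ (ξ α t) (ξ β t) +
        φ (x α t - x β t) * (inner ℝ (ξ α t) (ξ' β) + inner ℝ (ξ' α) (ξ β t)) =
      (Q α β + Q β α) + (P α β + P β α) := by
    intro α β
    simp only [P, Q, hφsymm β α, hgrad β α, inner_sub_right, inner_neg_left,
      real_inner_comm (ξ α t) (ξ β t), real_inner_comm (ξ β t) (ξ' α)]
    ring
  have hL : (∑ β, inner ℝ (discPsi φ (fun β' => x β' t) (fun β' => ξ β' t) (x β t)) (ξ' β)) =
      ∑ α, ∑ β, P α β := by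
    simp [P, discPsi, sum_inner, inner_smul_left]
  have hR : (∑ β, inner ℝ (ξ β t)
      (fderiv ℝ (discPsi φ (fun β' => x β' t) (fun β' => ξ β' t)) (x β t) (x' β))) =
      ∑ α, ∑ β, Q α β := by
    simp [Q, fderiv_discPsi_apply hφ, inner_sum, inner_smul_right]
  rw [hL, hR]
  simp only [hsplit, Finset.sum_add_distrib]
  rw [Finset.sum_comm (f := fun α β => Q β α), Finset.sum_comm (f := fun α β => P β α)]
  ring

/-- The energy rate formula for discrete vorticity models: along curves with
`ẋ_α = u_t(x_α)` (and arbitrary `ξ̇_α`),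
`dH/dt = ∑_β ⟨Ψ_t(x_β), ξ̇_β − Du_t(x_β) ξ_β⟩ + ∑_β ⟨ξ_β, ∇Φ_t(x_β)⟩`. -/
theorem discrete_energy_rate (φ : E3 → ℝ) (hφ : ContDiff ℝ 3 φ)
    (heven : ∀ x, φ (-x) = φ x) (N : ℕ) (hN : 0 < N) (T : ℝ) (hT : 0 < T)
    (x ξ : Fin N → ℝ → E3)
    (hx : ∀ α, ContDiff ℝ 1 (x α)) (hξ : ∀ α, ContDiff ℝ 1 (ξ α))
    (hode : ∀ t ∈ Icc (0:ℝ) T, ∀ α,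
      HasDerivAt (x α) (discVel φ (fun β => x β t) (fun β => ξ β t) (x α t)) t) :
    ∀ t ∈ Icc (0:ℝ) T,
      HasDerivAt (fun s => discEnergy φ (fun β => x β s) (fun β => ξ β s))
        ((∑ β, (inner ℝ (discPsi φ (fun β' => x β' t) (fun β' => ξ β' t) (x β t))
            (deriv (ξ β) t -
              fderiv ℝ (discVel φ (fun β' => x β' t) (fun β' => ξ β' t)) (x β t)
                (ξ β t)) : ℝ)) +
          ∑ β, (inner ℝ (ξ β t)
            (gradient (discPhi φ (fun β' => x β' t) (fun β' => ξ β' t)) (x β t)) : ℝ)) t := by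
  intro t ht
  have hφ2 : ContDiff ℝ 2 φ := hφ.of_le (by norm_num)
  have hd : Differentiable ℝ φ := hφ.differentiable (by norm_num)
  convert hasDerivAt_discEnergy hd heven (hode t ht)
    (fun α => ((hξ α).differentiable (by norm_num) t).hasDerivAt) using 1
  simp only [inner_sub_right, inner_gradient_discPhi hφ2, inner_fderiv_discPsi_discVel hd,
    Finset.sum_sub_distrib, Finset.sum_add_distrib]
  ring
end
end

section
/- Assume Hypothesis A. Then for any configuration (x_α, ξ_α)_{α=1,…,N}, with Φ(x) = ⟨Ψ(x), curl Ψ(x)⟩ one has the uniform bound sup_{x∈ℝ³} |Φ(x)| ≤ (∫_{ℝ³} φ̂(k) dk)^{1/2} (∫_{ℝ³} |k|² φ̂(k) dk)^{1/2} H. -/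
noncomputable section
open MeasureTheory Real Set

theorem HypA.integrable_mul {φ φhat : E3 → ℝ} (hA : HypA φ φhat) {g : E3 → ℝ}
    (hg : Continuous g) (C : ℝ) (hC : ∀ k, |g k| ≤ C * (1 + ‖k‖ ^ 2) ^ 2) :
    Integrable (fun k => g k * φhat k) := by
  have hpos : ∀ k : E3, 0 < (1 + ‖k‖ ^ 2) ^ 2 := fun k => by positivity
  have h := hA.moment.bdd_mul (f := fun k => g k / (1 + ‖k‖ ^ 2) ^ 2) (c := C)
    (Continuous.aestronglyMeasurable
      (hg.div (by fun_prop) fun k => (hpos k).ne'))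
    (Filter.Eventually.of_forall fun k => by
      rw [Real.norm_eq_abs, abs_div, abs_of_pos (hpos k), div_le_iff₀ (hpos k)]
      exact hC k)
  refine h.congr (Filter.Eventually.of_forall fun k => ?_)
  have := (hpos k).ne'
  field_simp

theorem HypA.integrable_cos {φ φhat : E3 → ℝ} (hA : HypA φ φhat) (y : E3) :
    Integrable (fun k => cos (inner ℝ k y) * φhat k) :=
  hA.integrable_mul (by fun_prop) 1 fun k => by
    nlinarith [sq_nonneg ‖k‖, sq_nonneg (‖k‖ ^ 2), abs_cos_le_one (inner ℝ k y)]

theorem HypA.eq_integral_cos {φ φhat : E3 → ℝ} (hA : HypA φ φhat) (y : E3) :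
    φ y = ((2 * π) ^ 3)⁻¹ * ∫ k, cos (inner ℝ k y) * φhat k := by
  have hint : Integrable φhat := by
    simpa using hA.integrable_cos 0
  have hF : ∀ w, FourierTransform.fourier (fun x => (φ x : ℂ)) w = (φhat ((-(2 * π)) • w) : ℂ) := by
    intro w
    rw [hA.fourier_eq, Real.fourier_eq', fourierInt]
    refine integral_congr_ae (Filter.Eventually.of_forall fun v => ?_)
    simp only [inner_smul_left, smul_eq_mul, real_inner_comm w v]
    congr 2
    push_cast
    simp
    ring
  have h2 : (-(2 * π)) ≠ 0 := by simp [pi_ne_zero]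
  have hFi : Integrable (FourierTransform.fourier (fun x => (φ x : ℂ))) := by
    rw [funext hF]
    exact ((integrable_comp_smul_iff volume φhat h2).2 hint).ofReal
  have key := congrFun (Continuous.fourierInv_fourier_eq
    (Complex.continuous_ofReal.comp hA.cont) hA.integrable.ofReal hFi) y
  rw [Real.fourierInv_eq'] at key
  have hG : (fun v : E3 => Complex.exp (((2 * π * inner ℝ v y : ℝ) : ℂ) * Complex.I) •
      FourierTransform.fourier (fun x => (φ x : ℂ)) v) = fun v => (fun k : E3 =>
        Complex.exp (((-inner ℝ k y : ℝ) : ℂ) * Complex.I) * (φhat k : ℂ))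
          ((-(2 * π)) • v) := by
    funext v
    rw [hF]
    simp [inner_smul_left]
  have key2 := (Measure.integral_comp_smul volume (fun k : E3 =>
    Complex.exp (((-inner ℝ k y : ℝ) : ℂ) * Complex.I) * (φhat k : ℂ)) (-(2 * π))).symm.trans
    ((congrArg (fun f : E3 → ℂ => ∫ v, f v) hG).symm.trans key)
  have hint2 : Integrable (fun k : E3 =>
        Complex.exp (((-inner ℝ k y : ℝ) : ℂ) * Complex.I) * (φhat k : ℂ)) := by
    refine hint.ofReal.bdd_mul (c := 1) (Continuous.aestronglyMeasurable (by fun_prop))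
      (Filter.Eventually.of_forall fun k => ?_)
    rw [Complex.norm_exp_ofReal_mul_I]
  have hre := congrArg Complex.re key2
  rw [Complex.real_smul, Complex.re_ofReal_mul, ← RCLike.re_eq_complex_re,
    ← integral_re hint2] at hre
  have hfin : Module.finrank ℝ E3 = 3 := by simp
  rw [hfin] at hre
  have hc : |((-(2 * π)) ^ 3)⁻¹| = ((2 * π) ^ 3)⁻¹ := by
    rw [abs_inv, abs_pow, abs_neg, abs_of_pos (by positivity)]
  rw [hc] at hre
  simp only [RCLike.re_eq_complex_re, Complex.re_mul_ofReal, Complex.exp_ofReal_mul_I_re,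
    cos_neg, Function.comp, Complex.ofReal_re] at hre
  exact hre.symm

theorem HypA.hasFDerivAt {φ φhat : E3 → ℝ} (hA : HypA φ φhat) (y : E3) :
    ∃ L : E3 →L[ℝ] ℝ, HasFDerivAt φ L y ∧ ∀ h, L h =
      -(((2 * π) ^ 3)⁻¹ * ∫ k, sin (inner ℝ k y) * inner ℝ k h * φhat k) := by
  have hint : Integrable (fun k => ‖k‖ * φhat k) :=
    hA.integrable_mul continuous_norm 1 fun k => by
      rw [abs_norm]; nlinarith [sq_nonneg (‖k‖ - 1), sq_nonneg (‖k‖ ^ 2)]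
  have hmeas : AEStronglyMeasurable φhat volume := by
    simpa using (hA.integrable_cos 0).aestronglyMeasurable
  let F' : E3 → E3 → (E3 →L[ℝ] ℝ) := fun y k =>
    (-(sin (inner ℝ k y) * φhat k)) • innerSL ℝ k
  have hF'n : ∀ y k, ‖F' y k‖ ≤ ‖k‖ * φhat k := fun y k => by
    simp only [F', norm_smul, norm_neg, norm_mul, innerSL_apply_norm, Real.norm_eq_abs,
      abs_of_nonneg (hA.nonneg k)]
    have := mul_le_mul_of_nonneg_right (abs_sin_le_one (inner ℝ k y))
      (mul_nonneg (hA.nonneg k) (norm_nonneg k))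
    linarith
  have hF'm : ∀ y, AEStronglyMeasurable (F' y) volume := fun y =>
    ((Continuous.aestronglyMeasurable (by fun_prop)).mul hmeas).neg.smul
      (innerSL ℝ).continuous.aestronglyMeasurable
  have hD : HasFDerivAt (fun y : E3 => ∫ k, cos (inner ℝ k y) * φhat k) (∫ k, F' y k) y := by
    refine hasFDerivAt_integral_of_dominated_of_fderiv_le (s := Set.univ)
      (bound := fun k => ‖k‖ * φhat k) Filter.univ_mem
      (Filter.Eventually.of_forall fun y => (hA.integrable_cos y).aestronglyMeasurable) (hA.integrable_cos y) (hF'm y)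
      (Filter.Eventually.of_forall fun k y _ => hF'n y k) hint
      (Filter.Eventually.of_forall fun k y _ => ?_)
    have h1 : HasFDerivAt (fun y : E3 => inner ℝ k y) (innerSL ℝ k) y :=
      (innerSL ℝ k).hasFDerivAt
    refine (h1.cos.mul_const (φhat k)).congr_fderiv ?_
    ext h
    simp [F']
    ring
  refine ⟨((2 * π) ^ 3)⁻¹ • ∫ k, F' y k, ?_, fun h => ?_⟩
  · rw [funext hA.eq_integral_cos]
    exact hD.const_mul _
  · have hF'i : Integrable (F' y) :=
      hint.mono' (hF'm y) (Filter.Eventually.of_forall (hF'n y))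
    rw [smul_apply, ContinuousLinearMap.integral_apply hF'i, smul_eq_mul,
      ← mul_neg, ← integral_neg]
    congr 2
    funext k
    simp [F']
    ring

/-- The weighted Cauchy–Schwarz inequality for integrals. -/
theorem abs_integral_mul_mul_le {X : Type*} [MeasurableSpace X] {μ : Measure X}
    {f g w : X → ℝ} (hw : ∀ k, 0 ≤ w k)
    (hf : Integrable (fun k => f k ^ 2 * w k) μ) (hg : Integrable (fun k => g k ^ 2 * w k) μ)
    (hfg : Integrable (fun k => f k * g k * w k) μ) :
    |∫ k, f k * g k * w k ∂μ| ≤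
      sqrt (∫ k, f k ^ 2 * w k ∂μ) * sqrt (∫ k, g k ^ 2 * w k ∂μ) := by
  have hf0 : 0 ≤ ∫ k, f k ^ 2 * w k ∂μ :=
    integral_nonneg fun k => mul_nonneg (sq_nonneg _) (hw k)
  rw [← sqrt_mul hf0]
  apply abs_le_sqrt
  have hq : ∀ t : ℝ, 0 ≤ (∫ k, f k ^ 2 * w k ∂μ) * (t * t) +
      (2 * ∫ k, f k * g k * w k ∂μ) * t + ∫ k, g k ^ 2 * w k ∂μ := by
    intro t
    have h : 0 ≤ ∫ k, (t * f k + g k) ^ 2 * w k ∂μ :=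
      integral_nonneg fun k => mul_nonneg (sq_nonneg _) (hw k)
    have he : (fun k => (t * f k + g k) ^ 2 * w k) = fun k =>
        ((t * t) * (f k ^ 2 * w k) + (2 * t) * (f k * g k * w k)) + g k ^ 2 * w k := by
      funext k; ring
    rw [he, integral_add ((hf.const_mul _).fun_add (hfg.const_mul _)) hg,
      integral_add (hf.const_mul _) (hfg.const_mul _), integral_const_mul,
      integral_const_mul] at h
    linarith
  have := discrim_le_zero hq
  rw [discrim] at this
  linarith

/-- The real part of `∑_α e^{i⟨k,y_α⟩} ξ_α`. -/
def cosSum {N : ℕ} (y ξ : Fin N → E3) (k : E3) : E3 := ∑ α, cos (inner ℝ k (y α)) • ξ α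

/-- The imaginary part of `∑_α e^{i⟨k,y_α⟩} ξ_α`. -/
def sinSum {N : ℕ} (y ξ : Fin N → E3) (k : E3) : E3 := ∑ α, sin (inner ℝ k (y α)) • ξ α

@[fun_prop]
theorem continuous_cosSum {N : ℕ} (y ξ : Fin N → E3) : Continuous (cosSum y ξ) := by
  unfold cosSum; fun_prop

@[fun_prop]
theorem continuous_sinSum {N : ℕ} (y ξ : Fin N → E3) : Continuous (sinSum y ξ) := by
  unfold sinSum; fun_prop

theorem norm_cosSum_le {N : ℕ} (y ξ : Fin N → E3) (k : E3) : ‖cosSum y ξ k‖ ≤ discLength ξ := by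
  refine (norm_sum_le _ _).trans (Finset.sum_le_sum fun α _ => ?_)
  rw [norm_smul]
  exact mul_le_of_le_one_left (norm_nonneg _) (abs_cos_le_one _)

theorem norm_sinSum_le {N : ℕ} (y ξ : Fin N → E3) (k : E3) : ‖sinSum y ξ k‖ ≤ discLength ξ := by
  refine (norm_sum_le _ _).trans (Finset.sum_le_sum fun α _ => ?_)
  rw [norm_smul]
  exact mul_le_of_le_one_left (norm_nonneg _) (abs_sin_le_one _)

theorem norm_sq_cosSum_add_norm_sq_sinSum {N : ℕ} (x ξ : Fin N → E3) (p k : E3) :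
    ‖cosSum (fun α => p - x α) ξ k‖ ^ 2 + ‖sinSum (fun α => p - x α) ξ k‖ ^ 2 =
      ∑ α, ∑ β, cos (inner ℝ k (x α - x β)) * inner ℝ (ξ α) (ξ β) := by
  rw [← real_inner_self_eq_norm_sq, ← real_inner_self_eq_norm_sq, cosSum, sinSum]
  simp only [sum_inner, inner_sum, inner_smul_left, inner_smul_right, ← Finset.sum_add_distrib,
    Finset.mul_sum]
  rw [Finset.sum_comm]
  refine Finset.sum_congr rfl fun α _ => Finset.sum_congr rfl fun β _ => ?_
  have h : (inner ℝ k (x α - x β) : ℝ) = inner ℝ k (p - x β) - inner ℝ k (p - x α) := by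
    rw [← inner_sub_right]; congr 1; abel
  rw [h, cos_sub]
  simp
  ring

theorem HypA.two_mul_discEnergy {φ φhat : E3 → ℝ} (hA : HypA φ φhat)
    {N : ℕ} (x ξ : Fin N → E3) (p : E3) :
    2 * discEnergy φ x ξ = ((2 * π) ^ 3)⁻¹ * ∫ k, (‖cosSum (fun α => p - x α) ξ k‖ ^ 2 +
      ‖sinSum (fun α => p - x α) ξ k‖ ^ 2) * φhat k := by
  have hi : ∀ α β, Integrable fun k =>
      cos (inner ℝ k (x α - x β)) * inner ℝ (ξ α) (ξ β) * φhat k := fun α β => by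
    simpa only [mul_right_comm] using
      (hA.integrable_cos (x α - x β)).mul_const (inner ℝ (ξ α) (ξ β))
  simp only [norm_sq_cosSum_add_norm_sq_sinSum, Finset.sum_mul]
  rw [integral_finsetSum _ fun α _ => integrable_finsetSum _ fun β _ => hi α β, discEnergy,
    ← mul_assoc, mul_one_div_cancel two_ne_zero, one_mul, Finset.mul_sum]
  refine Finset.sum_congr rfl fun α _ => ?_
  rw [integral_finsetSum _ fun β _ => hi α β, Finset.mul_sum]
  refine Finset.sum_congr rfl fun β _ => ?_
  rw [hA.eq_integral_cos, mul_assoc, ← integral_mul_const]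
  simp only [mul_right_comm]

theorem HypA.inner_discPsi {φ φhat : E3 → ℝ} (hA : HypA φ φhat)
    {N : ℕ} (x ξ : Fin N → E3) (p v : E3) :
    inner ℝ v (discPsi φ x ξ p) =
      ((2 * π) ^ 3)⁻¹ * ∫ k, inner ℝ v (cosSum (fun α => p - x α) ξ k) * φhat k := by
  simp only [discPsi, cosSum, inner_sum, inner_smul_right, Finset.sum_mul]
  rw [integral_finsetSum _ fun α _ => ?_, Finset.mul_sum]
  · refine Finset.sum_congr rfl fun α _ => ?_
    rw [hA.eq_integral_cos, mul_assoc, ← integral_mul_const]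
    simp only [mul_right_comm]
  · simpa only [mul_right_comm] using (hA.integrable_cos (p - x α)).mul_const (inner ℝ v (ξ α))

theorem HypA.integrable_inner_mul_sinSum {φ φhat : E3 → ℝ} (hA : HypA φ φhat)
    {N : ℕ} (y ξ : Fin N → E3) (h : E3) (j : Fin 3) :
    Integrable fun k => inner ℝ k h * sinSum y ξ k j * φhat k := by
  refine hA.integrable_mul (by fun_prop) (‖h‖ * discLength ξ) fun k => ?_
  have h1 := abs_real_inner_le_norm k h
  have h2 : |sinSum y ξ k j| ≤ discLength ξ :=
    (PiLp.norm_apply_le (sinSum y ξ k) j).trans (norm_sinSum_le y ξ k)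
  rw [abs_mul]
  have h3 : ‖k‖ ≤ (1 + ‖k‖ ^ 2) ^ 2 := by
    nlinarith [sq_nonneg (‖k‖ - 1), sq_nonneg (‖k‖ ^ 2)]
  have h0 : 0 ≤ discLength ξ := (abs_nonneg _).trans h2
  calc |inner ℝ k h| * |sinSum y ξ k j| ≤ (‖k‖ * ‖h‖) * discLength ξ := by gcongr
    _ = ‖h‖ * discLength ξ * ‖k‖ := by ring
    _ ≤ _ := by gcongr

theorem HypA.fderiv_discPsi_apply {φ φhat : E3 → ℝ} (hA : HypA φ φhat)
    {N : ℕ} (x ξ : Fin N → E3) (p h : E3) (j : Fin 3) :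
    fderiv ℝ (discPsi φ x ξ) p h j =
      -(((2 * π) ^ 3)⁻¹ * ∫ k, inner ℝ k h * sinSum (fun α => p - x α) ξ k j * φhat k) := by
  choose L hL hLh using hA.hasFDerivAt
  have hD : HasFDerivAt (discPsi φ x ξ) (∑ α, (L (p - x α)).smulRight (ξ α)) p := by
    unfold discPsi
    refine HasFDerivAt.fun_sum fun α _ => HasFDerivAt.smul_const ?_ (ξ α)
    exact (hasFDerivAt_comp_sub (x α)).2 (hL (p - x α))
  have hi : ∀ α, Integrable fun k =>
      inner ℝ k h * (sin (inner ℝ k (p - x α)) * ξ α j) * φhat k := fun α => by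
    simpa [sinSum] using
      hA.integrable_inner_mul_sinSum (fun _ : Fin 1 => p - x α) (fun _ => ξ α) h j
  rw [hD.fderiv]
  simp only [sinSum, sum_apply, ContinuousLinearMap.smulRight_apply,
    WithLp.ofLp_sum, Finset.sum_apply, WithLp.ofLp_smul, Pi.smul_apply, smul_eq_mul,
    Finset.mul_sum, Finset.sum_mul, hLh]
  rw [integral_finsetSum _ fun α _ => hi α, Finset.mul_sum, ← Finset.sum_neg_distrib]
  refine Finset.sum_congr rfl fun α _ => ?_
  rw [neg_mul, mul_assoc, ← integral_mul_const]
  congr 3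
  funext k
  ring

theorem HypA.inner_curl3_discPsi {φ φhat : E3 → ℝ} (hA : HypA φ φhat)
    {N : ℕ} (x ξ : Fin N → E3) (p v : E3) :
    inner ℝ v (curl3 (discPsi φ x ξ) p) = -(((2 * π) ^ 3)⁻¹ *
      ∫ k, inner ℝ v (cross3 k (sinSum (fun α => p - x α) ξ k)) * φhat k) := by
  set S := sinSum (fun α => p - x α) ξ
  have hi : ∀ i j, Integrable fun k : E3 => k i * S k j * φhat k := fun i j => by
    simpa [EuclideanSpace.inner_single_right] using
      hA.integrable_inner_mul_sinSum (fun α => p - x α) ξ (EuclideanSpace.single i 1) j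
  have hd : ∀ i j, fderiv ℝ (discPsi φ x ξ) p (EuclideanSpace.single i 1) j =
      -(((2 * π) ^ 3)⁻¹ * ∫ k : E3, k i * S k j * φhat k) := fun i j => by
    rw [hA.fderiv_discPsi_apply]
    simp [EuclideanSpace.inner_single_right, S]
  have he : (fun k => inner ℝ v (cross3 k (S k)) * φhat k) = fun k : E3 =>
      v 0 * (k 1 * S k 2 * φhat k - k 2 * S k 1 * φhat k) +
      v 1 * (k 2 * S k 0 * φhat k - k 0 * S k 2 * φhat k) +
      v 2 * (k 0 * S k 1 * φhat k - k 1 * S k 0 * φhat k) := by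
    funext k
    simp [cross3, crossProduct, PiLp.inner_apply, Fin.sum_univ_three]
    ring
  have hc : ∀ (c : ℝ) (i j i' j' : Fin 3), Integrable fun k : E3 =>
      c * (k i * S k j * φhat k - k i' * S k j' * φhat k) := fun c i j i' j' =>
    ((hi i j).sub (hi i' j')).const_mul c
  rw [he, integral_add ((hc _ _ _ _ _).fun_add (hc _ _ _ _ _)) (hc _ _ _ _ _),
    integral_add (hc _ _ _ _ _) (hc _ _ _ _ _)]
  simp only [integral_const_mul, integral_sub (hi _ _) (hi _ _)]
  simp only [curl3, PiLp.inner_apply, Fin.sum_univ_three, hd]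
  simp
  ring

theorem norm_cross3_le (a b : E3) : ‖cross3 a b‖ ≤ ‖a‖ * ‖b‖ := by
  refine abs_le_of_sq_le_sq' ?_ (by positivity) |>.2
  rw [mul_pow, EuclideanSpace.real_norm_sq_eq, EuclideanSpace.real_norm_sq_eq,
    EuclideanSpace.real_norm_sq_eq]
  simp only [cross3, crossProduct, Fin.sum_univ_three]
  simp
  nlinarith [sq_nonneg (a 0 * b 0 + a 1 * b 1 + a 2 * b 2)]

/-- If every `⟪v, F⟫` is an integral of `⟪v, G k⟫ w k` with `‖G k‖ ≤ f k * g k`, then `‖F‖` is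
controlled by the weighted `L²` norms of `f` and `g`. -/
theorem norm_le_of_forall_inner_eq_integral {F : E3} {G : E3 → E3} {f g w : E3 → ℝ} {c : ℝ}
    (hc : 0 ≤ c) (hw : ∀ k, 0 ≤ w k)
    (hF : ∀ v, |inner ℝ v F| = c * |∫ k, inner ℝ v (G k) * w k|)
    (hG : ∀ k, ‖G k‖ ≤ f k * g k) (hf : Integrable fun k => f k ^ 2 * w k)
    (hg : Integrable fun k => g k ^ 2 * w k) (hfg : Integrable fun k => f k * g k * w k) :
    ‖F‖ ≤ c * (√(∫ k, f k ^ 2 * w k) * √(∫ k, g k ^ 2 * w k)) := by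
  have hcs := (le_abs_self _).trans (abs_integral_mul_mul_le hw hf hg hfg)
  have hb : |∫ k, inner ℝ F (G k) * w k| ≤ ‖F‖ * ∫ k, f k * g k * w k := by
    rw [← integral_const_mul, ← Real.norm_eq_abs]
    refine norm_integral_le_of_norm_le (hfg.const_mul _) (Filter.Eventually.of_forall fun k => ?_)
    rw [norm_mul, Real.norm_of_nonneg (hw k), ← mul_assoc]
    refine mul_le_mul_of_nonneg_right ((abs_real_inner_le_norm _ _).trans ?_) (hw k)
    exact mul_le_mul_of_nonneg_left (hG k) (norm_nonneg _)
  have hsq : ‖F‖ * ‖F‖ ≤ ‖F‖ * (c * (√(∫ k, f k ^ 2 * w k) * √(∫ k, g k ^ 2 * w k))) := by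
    have h := hF F
    rw [real_inner_self_eq_norm_mul_norm, abs_of_nonneg (by positivity)] at h
    calc ‖F‖ * ‖F‖ = c * |∫ k, inner ℝ F (G k) * w k| := h
      _ ≤ c * (‖F‖ * (√(∫ k, f k ^ 2 * w k) * √(∫ k, g k ^ 2 * w k))) := by
        gcongr
        exact hb.trans (by gcongr)
      _ = _ := by ring
  rcases (norm_nonneg F).eq_or_lt with h0 | h0
  · rw [← h0]; positivity
  · exact le_of_mul_le_mul_left hsq h0

/-- Uniform bound on `Φ = ⟨Ψ, curl Ψ⟩`:
`sup_x |Φ(x)| ≤ (∫ φ̂(k) dk)^{1/2} (∫ |k|² φ̂(k) dk)^{1/2} H`. -/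
theorem discPhi_bound (φ φhat : E3 → ℝ) (hA : HypA φ φhat)
    (N : ℕ) (hN : 0 < N) (x ξ : Fin N → E3) :
    ∀ p : E3, |discPhi φ x ξ p| ≤
      Real.sqrt (∫ k : E3, φhat k) * Real.sqrt (∫ k : E3, ‖k‖ ^ 2 * φhat k) *
        discEnergy φ x ξ := by
  intro p
  set c : ℝ := ((2 * π) ^ 3)⁻¹ with hc
  set A := cosSum (fun α => p - x α) ξ with hAdef
  set B := sinSum (fun α => p - x α) ξ with hBdef
  have hc0 : 0 ≤ c := by positivity
  have hc1 : c ≤ 1 := inv_le_one_of_one_le₀ (one_le_pow₀ (by linarith [pi_gt_three]))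
  have hL0 : 0 ≤ discLength ξ := (norm_nonneg _).trans (norm_cosSum_le x ξ 0)
  have hone : ∀ k : E3, 1 ≤ (1 + ‖k‖ ^ 2) ^ 2 := fun k => by
    nlinarith [sq_nonneg ‖k‖, sq_nonneg (‖k‖ ^ 2)]
  have hA2 : Integrable fun k => ‖A k‖ ^ 2 * φhat k :=
    hA.integrable_mul (by fun_prop) (discLength ξ ^ 2) fun k => by
      rw [abs_of_nonneg (by positivity)]
      exact (pow_le_pow_left₀ (norm_nonneg _) (norm_cosSum_le _ ξ k) 2).trans
        (le_mul_of_one_le_right (by positivity) (hone k))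
  have hB2 : Integrable fun k => ‖B k‖ ^ 2 * φhat k :=
    hA.integrable_mul (by fun_prop) (discLength ξ ^ 2) fun k => by
      rw [abs_of_nonneg (by positivity)]
      exact (pow_le_pow_left₀ (norm_nonneg _) (norm_sinSum_le _ ξ k) 2).trans
        (le_mul_of_one_le_right (by positivity) (hone k))
  have h1 : Integrable fun k => (1 : ℝ) ^ 2 * φhat k :=
    hA.integrable_mul continuous_const 1 fun k => by simpa using hone k
  have h1A : Integrable fun k => 1 * ‖A k‖ * φhat k :=
    hA.integrable_mul (by fun_prop) (discLength ξ) fun k => by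
      rw [one_mul, abs_norm]
      exact (norm_cosSum_le _ ξ k).trans (le_mul_of_one_le_right hL0 (hone k))
  have hk : Integrable fun k => ‖k‖ ^ 2 * φhat k :=
    hA.integrable_mul (by fun_prop) 1 fun k => by
      rw [abs_of_nonneg (by positivity)]
      nlinarith [sq_nonneg ‖k‖, sq_nonneg (‖k‖ ^ 2)]
  have hkB : Integrable fun k => ‖k‖ * ‖B k‖ * φhat k :=
    hA.integrable_mul (by fun_prop) (discLength ξ) fun k => by
      rw [abs_of_nonneg (by positivity), mul_comm]
      have : ‖k‖ ≤ (1 + ‖k‖ ^ 2) ^ 2 := by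
        nlinarith [sq_nonneg (‖k‖ - 1), sq_nonneg (‖k‖ ^ 2)]
      exact mul_le_mul (norm_sinSum_le _ ξ k) this (norm_nonneg _) hL0
  have hΨ := norm_le_of_forall_inner_eq_integral (F := discPsi φ x ξ p) hc0 hA.nonneg
    (fun v => by rw [hA.inner_discPsi, abs_mul, abs_of_nonneg hc0])
    (fun k => (one_mul ‖A k‖).ge) h1 hA2 h1A
  have hcurl := norm_le_of_forall_inner_eq_integral (F := curl3 (discPsi φ x ξ) p) hc0 hA.nonneg
    (fun v => by rw [hA.inner_curl3_discPsi, abs_neg, abs_mul, abs_of_nonneg hc0])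
    (fun k => norm_cross3_le k (B k)) hk hB2 hkB
  have hE := hA.two_mul_discEnergy x ξ p
  simp only [add_mul] at hE
  rw [integral_add hA2 hB2] at hE
  simp only [one_pow, one_mul] at hΨ
  have ha0 : 0 ≤ ∫ k, ‖A k‖ ^ 2 * φhat k :=
    integral_nonneg fun k => mul_nonneg (sq_nonneg _) (hA.nonneg k)
  have hb0 : 0 ≤ ∫ k, ‖B k‖ ^ 2 * φhat k :=
    integral_nonneg fun k => mul_nonneg (sq_nonneg _) (hA.nonneg k)
  set a := ∫ k, ‖A k‖ ^ 2 * φhat k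
  set b := ∫ k, ‖B k‖ ^ 2 * φhat k
  set m := √(∫ k, φhat k)
  set n := √(∫ k : E3, ‖k‖ ^ 2 * φhat k)
  have hab : c * (√a * √b) ≤ discEnergy φ x ξ := by
    have : 2 * (√a * √b) ≤ a + b := by
      nlinarith [sq_nonneg (√a - √b), sq_sqrt ha0, sq_sqrt hb0]
    nlinarith [mul_le_mul_of_nonneg_left this hc0]
  calc |discPhi φ x ξ p| ≤ ‖discPsi φ x ξ p‖ * ‖curl3 (discPsi φ x ξ) p‖ :=
        abs_real_inner_le_norm _ _
    _ ≤ (c * (m * √a)) * (c * (n * √b)) := by gcongr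
    _ = c * (m * n * (c * (√a * √b))) := by ring
    _ ≤ m * n * (c * (√a * √b)) := mul_le_of_le_one_left (by positivity) hc1
    _ ≤ m * n * discEnergy φ x ξ := by gcongr
end
end
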